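/- For every fixed integer t ≥ 1 there exist a constant c > 0 and an integer N such that for all n ≥ N, the maximum size M(n,t) of a subset of S_n with pairwise Ulam distance greater than t satisfies M(n,t) ≥ c · n! · (log n) / n^{2t}. -/

import Mathlib

open scoped Classical

/-- A translocation: move the symbol at (0-indexed) position `i` to position `j`,
shifting intermediate symbols by one position. -/
def translocate {α : Type*} (l : List α) (i j : ℕ) : List α :=
  match l[i]? with
  | some a => (l.eraseIdx i).insertIdx j a
  | none => l

/-- The Ulam distance between two sequences: the minimum number of translocations
needed to transform `x` into `y`. -/
noncomputable def ulamDist {α : Type*} (x y : List α) : ℕ :=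
  sInf {m | ∃ g : ℕ → List α, g 0 = x ∧ g m = y ∧
    ∀ k < m, ∃ i j, i < (g k).length ∧ j < (g k).length ∧ i ≠ j ∧
      g (k+1) = translocate (g k) i j}

/-- The sequence form of a permutation of `{1,...,n}` (values written `1`-indexed). -/
def seqOf {n : ℕ} (π : Equiv.Perm (Fin n)) : List ℕ :=
  List.ofFn fun i => (π i : ℕ) + 1

/-- The Ulam distance between two permutations. -/
noncomputable def dU {n : ℕ} (π σ : Equiv.Perm (Fin n)) : ℕ :=
  ulamDist (seqOf π) (seqOf σ)

/-- Length of a longest common subsequence of two sequences. -/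
noncomputable def lcsLen {α : Type*} (x y : List α) : ℕ :=
  sSup {k | ∃ z : List α, z.Sublist x ∧ z.Sublist y ∧ z.length = k}

/-- Levenshtein distance: minimum number of insertions and deletions needed to
transform `x` into `y`. -/
noncomputable def levDist {α : Type*} (x y : List α) : ℕ :=
  sInf {m | ∃ g : ℕ → List α, g 0 = x ∧ g m = y ∧
    ∀ k < m, (∃ i a, i ≤ (g k).length ∧ g (k+1) = (g k).insertIdx i a) ∨
      (∃ i, i < (g k).length ∧ g (k+1) = (g k).eraseIdx i)}

/-- Hamming distance between two permutations: number of positions where they differ. -/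
def dH {m : ℕ} (a b : Equiv.Perm (Fin m)) : ℕ :=
  (Finset.univ.filter fun i => a i ≠ b i).card

/-- `bar π` = the permutation `π` of `{1,...,n}` extended to `{1,...,n+1}` by
appending the symbol `n+1` at the end (i.e. fixing the last point). -/
def bar {n : ℕ} (π : Equiv.Perm (Fin n)) : Equiv.Perm (Fin (n+1)) :=
  (Equiv.permCongr finSuccEquivLast).symm π.optionCongr

/-- The map `f : S_n → S_{n+1}`: `fmap π` sends each symbol `i` to the symbol
that cyclically follows `i` in the sequence form of `bar π`, i.e.
`f(π̄)_i = π̄_{π̄⁻¹(i)+1}` for `i ≤ n` and `f(π̄)_{n+1} = π̄_1`. -/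
def fmap {n : ℕ} (π : Equiv.Perm (Fin n)) : Equiv.Perm (Fin (n+1)) :=
  bar π * finRotate (n+1) * (bar π)⁻¹

/-- The deletion ball `D_t(π)`: all sequences of length `n - t` obtained from `π`
by deleting `t` symbols, i.e. all subsequences of `π` of length `n - t`. -/
def Dball {n : ℕ} (t : ℕ) (π : Equiv.Perm (Fin n)) : Set (List ℕ) :=
  {s | s.Sublist (seqOf π) ∧ s.length = n - t}

/-- `Mnt n t`: the maximum size of a subset of `S_n` whose distinct elements have
pairwise Ulam distance greater than `t`. -/
noncomputable def Mnt (n t : ℕ) : ℕ :=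
  sSup {m | ∃ C : Finset (Equiv.Perm (Fin n)),
    (∀ π ∈ C, ∀ σ ∈ C, π ≠ σ → t < dU π σ) ∧ C.card = m}

section HardCore

open Finset

variable {V : Type*} (G : SimpleGraph V)

/-- The independent sets of `G` contained in `S`. -/
noncomputable def indepSubsets (S : Finset V) : Finset (Finset V) :=
  S.powerset.filter fun W => G.IsIndepSet (W : Set V)

/-- The hard-core partition function of `G` restricted to `S`, at fugacity `μ`. -/
noncomputable def hardCoreZ (μ : ℝ) (S : Finset V) : ℝ :=
  ∑ W ∈ indepSubsets G S, μ ^ #W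

variable {G}

lemma mem_indepSubsets {S W : Finset V} :
    W ∈ indepSubsets G S ↔ W ⊆ S ∧ ∀ x ∈ W, ∀ y ∈ W, ¬ G.Adj x y := by
  simp only [indepSubsets, mem_filter, mem_powerset, and_congr_right_iff]
  intro _
  refine ⟨fun h x hx y hy hxy => h hx hy hxy.ne hxy, fun h x hx y hy _ => h x hx y hy⟩

lemma hardCoreZ_nonneg {μ : ℝ} (hμ : 0 ≤ μ) (S : Finset V) : 0 ≤ hardCoreZ G μ S :=
  sum_nonneg fun _ _ => pow_nonneg hμ _

lemma hardCoreZ_mono {μ : ℝ} (hμ : 0 ≤ μ) {S T : Finset V} (h : S ⊆ T) :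
    hardCoreZ G μ S ≤ hardCoreZ G μ T := by
  refine sum_le_sum_of_subset_of_nonneg ?_ fun _ _ _ => pow_nonneg hμ _
  intro W hW
  rw [mem_indepSubsets] at hW ⊢
  exact ⟨hW.1.trans h, hW.2⟩

lemma hardCoreZ_empty (μ : ℝ) : hardCoreZ G μ ∅ = 1 := by
  have : indepSubsets G ∅ = {∅} := by
    ext W
    simp only [mem_indepSubsets, subset_empty, mem_singleton, and_iff_left_iff_imp]
    rintro rfl
    simp
  simp [hardCoreZ, this]

lemma one_le_hardCoreZ {μ : ℝ} (hμ : 0 ≤ μ) (S : Finset V) : 1 ≤ hardCoreZ G μ S := by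
  rw [← hardCoreZ_empty (G := G) μ]
  exact hardCoreZ_mono hμ (empty_subset _)

/-- Total weight of the independent subsets of `S` containing `u`. -/
lemma sum_indepSubsets_mem (μ : ℝ) {S : Finset V} {u : V} (hu : u ∈ S) :
    ∑ W ∈ indepSubsets G S with u ∈ W, μ ^ #W =
      μ * hardCoreZ G μ (S.filter fun z => z ≠ u ∧ ¬ G.Adj u z) := by
  rw [hardCoreZ, mul_sum]
  refine sum_nbij' (fun W => W.erase u) (fun W => insert u W) ?_ ?_ ?_ ?_ ?_
  · intro W hW
    rw [mem_filter, mem_indepSubsets] at hW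
    rw [mem_indepSubsets]
    refine ⟨fun z hz => ?_, fun x hx y hy => hW.1.2 x (mem_of_mem_erase hx) y (mem_of_mem_erase hy)⟩
    rw [mem_erase] at hz
    exact mem_filter.2 ⟨hW.1.1 hz.2, hz.1, hW.1.2 u hW.2 z hz.2⟩
  · intro W hW
    rw [mem_indepSubsets] at hW
    rw [mem_filter, mem_indepSubsets]
    have h1 : ∀ z ∈ W, z ∈ S ∧ z ≠ u ∧ ¬ G.Adj u z := fun z hz => mem_filter.1 (hW.1 hz)
    refine ⟨⟨insert_subset hu fun z hz => (h1 z hz).1, ?_⟩, mem_insert_self _ _⟩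
    intro x hx y hy
    rw [mem_insert] at hx hy
    rcases hx with rfl | hx <;> rcases hy with rfl | hy
    · exact G.irrefl
    · exact (h1 y hy).2.2
    · exact fun h => (h1 x hx).2.2 h.symm
    · exact hW.2 x hx y hy
  · intro W hW
    exact insert_erase (mem_filter.1 hW).2
  · intro W hW
    rw [mem_indepSubsets] at hW
    exact erase_insert fun h => (mem_filter.1 (hW.1 h)).2.1 rfl
  · intro W hW
    rw [← card_erase_add_one (mem_filter.1 hW).2, pow_succ, mul_comm]

lemma hardCoreZ_insert_le {μ : ℝ} (hμ : 0 ≤ μ) (u : V) (S : Finset V) :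
    hardCoreZ G μ (insert u S) ≤ (1 + μ) * hardCoreZ G μ S := by
  have h := sum_filter_add_sum_filter_not (indepSubsets G (insert u S)) (fun W => u ∈ W)
    (fun W => μ ^ #W)
  rw [sum_indepSubsets_mem μ (mem_insert_self u S)] at h
  rw [hardCoreZ, ← h, add_mul, one_mul, add_comm]
  refine add_le_add ?_ (mul_le_mul_of_nonneg_left (hardCoreZ_mono hμ ?_) hμ)
  · refine sum_le_sum_of_subset_of_nonneg ?_ fun _ _ _ => pow_nonneg hμ _
    intro W hW
    rw [mem_filter, mem_indepSubsets] at hW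
    rw [mem_indepSubsets]
    exact ⟨(subset_insert_iff_of_notMem hW.2).1 hW.1.1, hW.1.2⟩
  · intro z hz
    rw [mem_filter, mem_insert] at hz
    tauto

lemma hardCoreZ_union_le {μ : ℝ} (hμ : 0 ≤ μ) (A S : Finset V) :
    hardCoreZ G μ (A ∪ S) ≤ Real.exp (μ * #A) * hardCoreZ G μ S := by
  induction A using Finset.induction_on with
  | empty => simp
  | insert u A hu ih =>
    rw [insert_union, card_insert_of_notMem hu]
    refine (hardCoreZ_insert_le hμ u _).trans ?_
    have h1 : 1 + μ ≤ Real.exp μ := by linarith [Real.add_one_le_exp μ]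
    calc (1 + μ) * hardCoreZ G μ (A ∪ S)
        ≤ Real.exp μ * (Real.exp (μ * #A) * hardCoreZ G μ S) :=
          mul_le_mul h1 ih (hardCoreZ_nonneg hμ _) (Real.exp_pos _).le
      _ = _ := by
          rw [← mul_assoc, ← Real.exp_add]
          congr 2
          push_cast
          ring

lemma hardCoreZ_le_exp {μ : ℝ} (hμ : 0 ≤ μ) (S : Finset V) :
    hardCoreZ G μ S ≤ Real.exp (μ * #S) := by
  simpa [hardCoreZ_empty] using hardCoreZ_union_le (G := G) hμ S ∅

/-- In a set of small maximum degree, a hard-core random independent set at small fugacity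
occupies a proportion of order `μ` of the vertices. -/
lemma card_mul_hardCoreZ_le {μ : ℝ} (hμ : 0 ≤ μ) {S : Finset V} {l : ℕ}
    (hl : μ * (l + 1) ≤ 2) (hS : ∀ u ∈ S, #(S.filter (G.Adj u)) ≤ l) :
    Real.exp (-2) * (μ * #S) * hardCoreZ G μ S ≤ ∑ W ∈ indepSubsets G S, μ ^ #W * #W := by
  have h1 : ∑ W ∈ indepSubsets G S, μ ^ #W * #W =
      ∑ u ∈ S, μ * hardCoreZ G μ (S.filter fun z => z ≠ u ∧ ¬ G.Adj u z) := by
    rw [← sum_congr rfl fun u hu => sum_indepSubsets_mem (G := G) μ hu]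
    simp only [sum_filter]
    rw [sum_comm]
    refine sum_congr rfl fun W hW => ?_
    rw [← sum_filter, sum_const, nsmul_eq_mul, mul_comm, filter_mem_eq_inter,
      inter_eq_right.2 (mem_indepSubsets.1 hW).1]
  have h2 : ∀ u ∈ S, Real.exp (-2) * hardCoreZ G μ S ≤
      hardCoreZ G μ (S.filter fun z => z ≠ u ∧ ¬ G.Adj u z) := by
    intro u hu
    have h3 : hardCoreZ G μ S ≤ Real.exp (μ * #(insert u (S.filter (G.Adj u)))) *
        hardCoreZ G μ (S.filter fun z => z ≠ u ∧ ¬ G.Adj u z) := by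
      refine le_trans (hardCoreZ_mono hμ ?_) (hardCoreZ_union_le hμ _ _)
      intro z hz
      simp only [mem_union, mem_insert, mem_filter]
      tauto
    have h4 : (#(insert u (S.filter (G.Adj u))) : ℝ) ≤ l + 1 := by
      exact_mod_cast (card_insert_le _ _).trans (Nat.add_le_add_right (hS u hu) 1)
    have h5 : Real.exp (μ * #(insert u (S.filter (G.Adj u)))) ≤ Real.exp 2 :=
      Real.exp_le_exp.2 ((mul_le_mul_of_nonneg_left h4 hμ).trans hl)
    rw [Real.exp_neg, inv_mul_le_iff₀ (Real.exp_pos _)]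
    exact h3.trans (mul_le_mul_of_nonneg_right h5 (hardCoreZ_nonneg hμ _))
  rw [h1]
  calc Real.exp (-2) * (μ * #S) * hardCoreZ G μ S
      = ∑ u ∈ S, μ * (Real.exp (-2) * hardCoreZ G μ S) := by
        rw [sum_const, nsmul_eq_mul]; ring
    _ ≤ _ := sum_le_sum fun u hu => mul_le_mul_of_nonneg_left (h2 u hu) hμ

/-- The optimisation behind the lower bound for the local occupancy. -/
lemma local_occupancy_ineq {μ D K y Z M : ℝ} (hμ1 : μ ≤ 1)
    (hK : 0 ≤ K) (hD : Real.exp (2 * K * (Real.exp 2 + 1)) ≤ μ * D) (hy : 0 ≤ y)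
    (hZ1 : 1 ≤ Z) (hZ : Z ≤ Real.exp y) (hM : Real.exp (-2) * y * Z ≤ M) :
    0 ≤ μ * (D - K) + (M - K * Z) := by
  have hmul : 2 * K * Z ≤ μ * D + M := by
    rcases le_total (2 * K) (Real.exp (-2) * y) with h | h
    · have : 2 * K * Z ≤ Real.exp (-2) * y * Z := by gcongr
      have := (Real.exp_pos (2 * K * (Real.exp 2 + 1))).le
      linarith
    · have hyK : y ≤ 2 * K * Real.exp 2 := by
        rw [Real.exp_neg, inv_mul_le_iff₀ (Real.exp_pos _)] at h
        linarith
      have hM0 : 0 ≤ M := le_trans (by positivity) hM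
      have hK1 : 2 * K ≤ Real.exp (2 * K) := by linarith [Real.add_one_le_exp (2 * K)]
      have : 2 * K * Z ≤ Real.exp (2 * K) * Real.exp (2 * K * Real.exp 2) :=
        mul_le_mul hK1 (hZ.trans (Real.exp_le_exp.2 hyK)) (by linarith) (Real.exp_pos _).le
      rw [← Real.exp_add] at this
      have e : 2 * K + 2 * K * Real.exp 2 = 2 * K * (Real.exp 2 + 1) := by ring
      rw [e] at this
      linarith
  have : K * μ ≤ K * Z := by gcongr; linarith
  nlinarith

variable [Fintype V]

/-- The independent sets whose trace outside the closed neighbourhood of `v` is `U` have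
nonnegative total excess. -/
lemma fiber_excess_nonneg {μ D K : ℝ} (hμ : 0 ≤ μ) (hμ1 : μ ≤ 1) {l : ℕ}
    (hl : μ * (l + 1) ≤ 2)
    (hcodeg : ∀ u v, G.Adj u v → #{z | G.Adj u z ∧ G.Adj v z} ≤ l)
    (hK : 0 ≤ K) (hD : Real.exp (2 * K * (Real.exp 2 + 1)) ≤ μ * D) (v : V) (U : Finset V)
    (hU : U ∈ indepSubsets G univ) (hUv : ∀ z ∈ U, z ≠ v ∧ ¬ G.Adj v z) :
    0 ≤ ∑ W ∈ indepSubsets G univ with W.filter (fun z => z ≠ v ∧ ¬ G.Adj v z) = U,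
      μ ^ #W * ((if v ∈ W then D else 0) + #(W.filter (G.Adj v)) - K) := by
  set H : Finset V := univ.filter fun z => G.Adj v z ∧ ∀ x ∈ U, ¬ G.Adj x z with hH
  have hvH : v ∉ H := by simp [hH]
  have hI : indepSubsets G (insert v H) = insert {v} (indepSubsets G H) := by
    ext J
    rw [mem_insert, mem_indepSubsets, mem_indepSubsets]
    constructor
    · rintro ⟨h1, h2⟩
      by_cases hv : v ∈ J
      · left
        refine eq_singleton_iff_unique_mem.2 ⟨hv, fun x hx => ?_⟩
        rcases mem_insert.1 (h1 hx) with h | h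
        · exact h
        · exact absurd (mem_filter.1 h).2.1 (h2 v hv x hx)
      · exact Or.inr ⟨(subset_insert_iff_of_notMem hv).1 h1, h2⟩
    · rintro (rfl | ⟨h1, h2⟩)
      · simp
      · exact ⟨h1.trans (subset_insert _ _), h2⟩
  have hfib : ∑ W ∈ indepSubsets G univ with W.filter (fun z => z ≠ v ∧ ¬ G.Adj v z) = U,
      μ ^ #W * ((if v ∈ W then D else 0) + #(W.filter (G.Adj v)) - K) =
      ∑ J ∈ indepSubsets G (insert v H),
        μ ^ #U * (μ ^ #J * ((if v ∈ J then D else 0) + #(J.filter (G.Adj v)) - K)) := by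
    have hJ : ∀ J ∈ indepSubsets G (insert v H), ∀ z ∈ J,
        (z = v ∨ G.Adj v z) ∧ ∀ x ∈ U, ¬ G.Adj x z := by
      intro J hJ z hz
      rw [mem_indepSubsets] at hJ
      rcases mem_insert.1 (hJ.1 hz) with h | h
      · subst h
        exact ⟨Or.inl rfl, fun x hx h => (hUv x hx).2 h.symm⟩
      · have := (mem_filter.1 h).2
        exact ⟨Or.inr this.1, this.2⟩
    symm
    refine sum_nbij' (fun J => U ∪ J) (fun W => W.filter fun z => z = v ∨ G.Adj v z)
      ?_ ?_ ?_ ?_ ?_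
    · intro J hJm
      have h := hJ J hJm
      rw [mem_indepSubsets] at hJm hU
      rw [mem_filter, mem_indepSubsets]
      refine ⟨⟨subset_univ _, ?_⟩, ?_⟩
      · intro x hx y hy
        rcases mem_union.1 hx with hx | hx <;> rcases mem_union.1 hy with hy | hy
        · exact hU.2 x hx y hy
        · exact (h y hy).2 x hx
        · exact fun hxy => (h x hx).2 y hy hxy.symm
        · exact hJm.2 x hx y hy
      · ext z
        rw [mem_filter, mem_union]
        constructor
        · rintro ⟨h1 | h1, h2⟩
          · exact h1
          · have := (h z h1).1
            tauto
        · exact fun h1 => ⟨Or.inl h1, hUv z h1⟩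
    · intro W hW
      rw [mem_filter, mem_indepSubsets] at hW
      obtain ⟨⟨-, hW⟩, rfl⟩ := hW
      rw [mem_indepSubsets]
      refine ⟨fun z hz => ?_, fun x hx y hy => hW x (mem_filter.1 hx).1 y (mem_filter.1 hy).1⟩
      rw [mem_filter] at hz
      rw [mem_insert]
      refine hz.2.imp_right fun h => mem_filter.2 ⟨mem_univ _, h, fun x hx => ?_⟩
      exact hW x (mem_filter.1 hx).1 z hz.1
    · intro J hJm
      ext z
      simp only [mem_filter, mem_union]
      have h := hJ J hJm z
      have h' := hUv z
      tauto
    · intro W hW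
      rw [mem_filter] at hW
      obtain ⟨-, rfl⟩ := hW
      ext z
      simp only [mem_filter, mem_union]
      tauto
    · intro J hJm
      have h := hJ J hJm
      have hdisj : Disjoint U J := by
        rw [disjoint_left]
        intro z hz hz'
        have := hUv z hz
        have := (h z hz').1
        tauto
      have e1 : (v ∈ U ∪ J) ↔ v ∈ J := by
        rw [mem_union, or_iff_right]
        exact fun hv => (hUv v hv).1 rfl
      have e2 : (U ∪ J).filter (G.Adj v) = J.filter (G.Adj v) := by
        rw [filter_union, filter_false_of_mem fun z hz => (hUv z hz).2, empty_union]
      simp only [e1, e2, card_union_of_disjoint hdisj, pow_add]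
      ring
  rw [hfib, ← mul_sum]
  refine mul_nonneg (pow_nonneg hμ _) ?_
  have hvI : {v} ∉ indepSubsets G H := by
    rw [mem_indepSubsets, singleton_subset_iff]
    exact fun h => hvH h.1
  rw [hI, sum_insert hvI]
  have e1 : ∑ J ∈ indepSubsets G H,
      μ ^ #J * ((if v ∈ J then D else 0) + #(J.filter (G.Adj v)) - K) =
      ∑ J ∈ indepSubsets G H, μ ^ #J * #J - K * hardCoreZ G μ H := by
    rw [hardCoreZ, mul_sum, ← sum_sub_distrib]
    refine sum_congr rfl fun J hJ => ?_
    have hJ := (mem_indepSubsets.1 hJ).1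
    rw [if_neg fun h => hvH (hJ h), filter_true_of_mem fun z hz => (mem_filter.1 (hJ hz)).2.1]
    ring
  have e2 : ({v} : Finset V).filter (G.Adj v) = ∅ := by
    rw [filter_singleton, if_neg G.irrefl]
  rw [e1, e2]
  simp only [card_singleton, pow_one, mem_singleton, if_true, card_empty, Nat.cast_zero, add_zero]
  refine local_occupancy_ineq hμ1 hK hD (y := μ * #H) (by positivity) (one_le_hardCoreZ hμ _)
    (hardCoreZ_le_exp hμ _) (card_mul_hardCoreZ_le hμ hl fun u hu => ?_)
  refine (card_le_card ?_).trans (hcodeg v u (mem_filter.1 hu).2.1)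
  intro z hz
  rw [mem_filter] at hz ⊢
  exact ⟨mem_univ _, (mem_filter.1 hz.1).2.1, hz.2⟩

/-- A graph with maximum degree at most `D` in which adjacent vertices have at most `l` common
neighbours has an independent set of size of order `|V| log (D / l) / D`. -/
theorem exists_large_indepSet {D l : ℕ} (hl : 1 ≤ l) (hlD : l ≤ D)
    (hdeg : ∀ v, #{z | G.Adj v z} ≤ D)
    (hcodeg : ∀ u v, G.Adj u v → #{z | G.Adj u z ∧ G.Adj v z} ≤ l) :
    ∃ C : Finset V, (∀ x ∈ C, ∀ y ∈ C, ¬ G.Adj x y) ∧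
      (Fintype.card V : ℝ) * (Real.log (D / l) / (2 * (Real.exp 2 + 1))) ≤ 2 * D * #C := by
  have hl0 : (0 : ℝ) < l := by exact_mod_cast hl
  have hl1 : (1 : ℝ) ≤ l := by exact_mod_cast hl
  have hlD' : (l : ℝ) ≤ D := by exact_mod_cast hlD
  set μ : ℝ := 1 / l with hμdef
  have hμ : 0 ≤ μ := by positivity
  have hμ1 : μ ≤ 1 := by rw [hμdef, div_le_one hl0]; exact hl1
  have hμl : μ * (l + 1) ≤ 2 := by
    rw [hμdef, div_mul_eq_mul_div, div_le_iff₀ hl0]; linarith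
  set K : ℝ := Real.log (D / l) / (2 * (Real.exp 2 + 1)) with hKdef
  have hR : 1 ≤ (D : ℝ) / l := by rwa [one_le_div hl0]
  have hK : 0 ≤ K := div_nonneg (Real.log_nonneg hR) (by positivity)
  have hD : Real.exp (2 * K * (Real.exp 2 + 1)) ≤ μ * D := by
    have : 2 * K * (Real.exp 2 + 1) = Real.log (D / l) := by
      rw [hKdef]; field_simp
    rw [this, Real.exp_log (by linarith), hμdef]
    exact le_of_eq (by ring)
  have hne : (indepSubsets G (univ : Finset V)).Nonempty :=
    ⟨∅, mem_indepSubsets.2 ⟨empty_subset _, by simp⟩⟩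
  obtain ⟨C, hC, hmax⟩ := exists_max_image (indepSubsets G univ) card hne
  refine ⟨C, (mem_indepSubsets.1 hC).2, ?_⟩
  have hloc : ∀ v : V, 0 ≤ ∑ W ∈ indepSubsets G univ,
      μ ^ #W * ((if v ∈ W then (D : ℝ) else 0) + #(W.filter (G.Adj v)) - K) := by
    intro v
    have hmaps : ∀ W ∈ indepSubsets G univ,
        W.filter (fun z => z ≠ v ∧ ¬ G.Adj v z) ∈
          (indepSubsets G univ).filter fun U => ∀ z ∈ U, z ≠ v ∧ ¬ G.Adj v z := by
      intro W hW
      rw [mem_indepSubsets] at hW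
      rw [mem_filter, mem_indepSubsets]
      exact ⟨⟨subset_univ _, fun x hx y hy =>
        hW.2 x (mem_filter.1 hx).1 y (mem_filter.1 hy).1⟩, fun z hz => (mem_filter.1 hz).2⟩
    rw [← sum_fiberwise_of_maps_to hmaps]
    refine sum_nonneg fun U hU => ?_
    rw [mem_filter] at hU
    exact fiber_excess_nonneg hμ hμ1 hμl hcodeg hK hD v U hU.1 hU.2
  have hsum := sum_nonneg fun v (_ : v ∈ (univ : Finset V)) => hloc v
  rw [sum_comm] at hsum
  have hW : ∀ W ∈ indepSubsets G univ,
      ∑ v : V, μ ^ #W * ((if v ∈ W then (D : ℝ) else 0) + #(W.filter (G.Adj v)) - K) ≤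
      μ ^ #W * (2 * D * #C - Fintype.card V * K) := by
    intro W hW
    rw [← mul_sum]
    refine mul_le_mul_of_nonneg_left ?_ (pow_nonneg hμ _)
    rw [sum_sub_distrib, sum_add_distrib, sum_const, card_univ, nsmul_eq_mul]
    have h1 : ∑ v : V, (if v ∈ W then (D : ℝ) else 0) = #W * D := by
      rw [← sum_filter, sum_const, nsmul_eq_mul]
      congr 3
      ext; simp
    have h2 : ∑ v : V, (#(W.filter (G.Adj v)) : ℝ) ≤ #W * D := by
      have : ∑ v : V, #(W.filter (G.Adj v)) ≤ #W * D := by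
        simp only [card_filter]
        rw [sum_comm]
        refine (sum_le_card_nsmul _ _ D fun x _ => ?_).trans_eq (smul_eq_mul _ _)
        rw [← card_filter]
        refine le_trans (card_le_card ?_) (hdeg x)
        intro z
        simp [G.adj_comm]
      exact_mod_cast this
    have h3 : (#W : ℝ) * D ≤ #C * D := by
      have : (#W : ℝ) ≤ #C := by exact_mod_cast hmax W hW
      gcongr
    linarith
  have hfin := hsum.trans (sum_le_sum hW)
  rw [← sum_mul] at hfin
  have hZ : 0 < ∑ W ∈ indepSubsets G (univ : Finset V), μ ^ #W :=
    lt_of_lt_of_le one_pos (one_le_hardCoreZ hμ univ)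
  have := nonneg_of_mul_nonneg_right hfin hZ
  linarith

end HardCore

section Translocations

variable {α : Type*}

lemma translocate_cons (a : α) (l : List α) (i j : ℕ) :
    translocate (a :: l) (i + 1) (j + 1) = a :: translocate l i j := by
  unfold translocate
  simp only [List.getElem?_cons_succ]
  cases l[i]? <;> simp

/-- One translocation with distinct valid positions. -/
def TranslocStep (x y : List α) : Prop :=
  ∃ i j, i < x.length ∧ j < x.length ∧ i ≠ j ∧ y = translocate x i j

lemma exists_chain_of_reflTransGen {x y : List α}
    (h : Relation.ReflTransGen TranslocStep x y) :
    ∃ m, ∃ g : ℕ → List α, g 0 = x ∧ g m = y ∧ ∀ k < m, TranslocStep (g k) (g (k + 1)) := by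
  induction h with
  | refl => exact ⟨0, fun _ => x, rfl, rfl, by simp⟩
  | @tail b c _ hbc ih =>
    obtain ⟨m, g, h0, hm, hg⟩ := ih
    refine ⟨m + 1, fun k => if k ≤ m then g k else c, by simp [h0], by simp, ?_⟩
    intro k hk
    rcases Nat.lt_succ_iff_lt_or_eq.1 hk with h | rfl
    · simpa [h.le, Nat.succ_le_of_lt h] using hg k h
    · simpa [hm] using hbc

lemma reflTransGen_translocStep_of_perm {x y : List α} (h : x.Perm y) :
    Relation.ReflTransGen TranslocStep x y := by
  induction h with
  | nil => exact .refl
  | cons a _ ih =>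
    refine ih.lift (a :: ·) ?_
    rintro u v ⟨i, j, hi, hj, hij, rfl⟩
    exact ⟨i + 1, j + 1, by simpa using hi, by simpa using hj, by simpa using hij,
      (translocate_cons a u i j).symm⟩
  | swap a b l =>
    exact .single ⟨0, 1, by simp, by simp, by simp, by simp [translocate]⟩
  | trans _ _ ih1 ih2 => exact ih1.trans ih2

lemma exists_filter_translocate_eq (x : List ℕ) (i j : ℕ) (hj : j < x.length) :
    ∃ a, ∀ p : ℕ → Bool, p a = false → (translocate x i j).filter p = x.filter p := by
  unfold translocate
  cases h : x[i]? with
  | none => exact ⟨0, fun _ _ => rfl⟩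
  | some a =>
    refine ⟨a, fun p hp => ?_⟩
    obtain ⟨hi, hia⟩ := List.getElem?_eq_some_iff.1 h
    have hlen : j ≤ (x.eraseIdx i).length := by
      rw [List.length_eraseIdx_of_lt hi]; omega
    have key : ∀ l : List ℕ, ∀ k, k ≤ l.length → (l.insertIdx k a).filter p = l.filter p := by
      intro l
      induction l with
      | nil => intro k hk; simp at hk; subst hk; simp [hp]
      | cons b l ih =>
        intro k hk
        cases k with
        | zero => simp [hp]
        | succ k => simp [List.filter_cons, ih k (by simpa using hk)]
    simp only
    rw [key _ _ hlen]
    have : x = (x.eraseIdx i).insertIdx i a := by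
      rw [← hia, List.insertIdx_eraseIdx_getElem hi]
    conv_rhs => rw [this]
    rw [key]
    rw [List.length_eraseIdx_of_lt hi]; omega

lemma exists_filter_eq_of_chain {m : ℕ} {g : ℕ → List ℕ}
    (hg : ∀ k < m, TranslocStep (g k) (g (k + 1))) :
    ∃ S : Finset ℕ, S.card ≤ m ∧
      (g 0).filter (fun z => decide (z ∉ S)) = (g m).filter (fun z => decide (z ∉ S)) := by
  induction m with
  | zero => exact ⟨∅, by simp, rfl⟩
  | succ m ih =>
    obtain ⟨S, hS, hS'⟩ := ih fun k hk => hg k (by omega)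
    obtain ⟨i, j, -, hj, -, h⟩ := hg m (by omega)
    obtain ⟨a, ha⟩ := exists_filter_translocate_eq (g m) i j hj
    refine ⟨insert a S, (Finset.card_insert_le _ _).trans (by omega), ?_⟩
    rw [h, ha _ (by simp)]
    have e : ∀ l : List ℕ, l.filter (fun z => decide (z ∉ insert a S)) =
        (l.filter (fun z => decide (z ∉ S))).filter (fun z => decide (z ≠ a)) := by
      intro l
      rw [List.filter_filter]
      refine List.filter_congr fun z _ => ?_
      simp only [Finset.mem_insert, not_or, Bool.decide_and]
    rw [e, e, hS']

lemma exists_filter_eq_of_ulamDist_le {x y : List ℕ} {t : ℕ} (h : x.Perm y)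
    (ht : ulamDist x y ≤ t) : ∃ S : Finset ℕ, S.card ≤ t ∧
      x.filter (fun z => decide (z ∉ S)) = y.filter (fun z => decide (z ∉ S)) := by
  have hne := exists_chain_of_reflTransGen (reflTransGen_translocStep_of_perm h)
  obtain ⟨g, h0, hm, hg⟩ := Nat.sInf_mem hne
  obtain ⟨S, hS, hS'⟩ := exists_filter_eq_of_chain hg
  rw [h0, hm] at hS'
  exact ⟨S, hS.trans ht, hS'⟩

lemma seqOf_perm {n : ℕ} (π σ : Equiv.Perm (Fin n)) : (seqOf π).Perm (seqOf σ) := by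
  unfold seqOf
  have := Equiv.Perm.ofFn_comp_perm (σ⁻¹ * π) (fun i => (σ i : ℕ) + 1)
  simpa [Function.comp_def] using this

lemma pairwise_seqOf {n : ℕ} (π : Equiv.Perm (Fin n)) :
    (seqOf π).Pairwise fun u v => ∀ x y : Fin n, (x : ℕ) + 1 = u → (y : ℕ) + 1 = v →
      π⁻¹ x < π⁻¹ y := by
  unfold seqOf
  rw [List.pairwise_ofFn]
  intro i j hij x y hx hy
  have hx' : x = π i := Fin.ext (by omega)
  have hy' : y = π j := Fin.ext (by omega)
  simpa [hx', hy'] using hij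

/-- The position functions `p` and `q` order the symbols outside some `t`-set identically. -/
def AgreeOff {n : ℕ} (t : ℕ) (p q : Equiv.Perm (Fin n)) : Prop :=
  ∃ S : Finset (Fin n), S.card = t ∧ ∀ x ∉ S, ∀ y ∉ S, p x < p y → q x < q y

lemma agreeOff_of_dU_le {n t : ℕ} (hn : t ≤ n) {π σ : Equiv.Perm (Fin n)} (h : dU π σ ≤ t) :
    AgreeOff t π⁻¹ σ⁻¹ := by
  obtain ⟨S, hS, hS'⟩ := exists_filter_eq_of_ulamDist_le (seqOf_perm π σ) h
  set S₁ : Finset (Fin n) := Finset.univ.filter fun x => (x : ℕ) + 1 ∈ S with hS₁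
  have hcard : S₁.card ≤ t := by
    refine le_trans (Finset.card_le_card_of_injOn (fun x : Fin n => (x : ℕ) + 1) ?_ ?_) hS
    · intro x hx
      simpa [hS₁] using hx
    · intro x _ y _ hxy
      exact Fin.ext (by simpa using hxy)
  obtain ⟨S₂, h12, h2⟩ := Finset.exists_superset_card_eq hcard (by simpa using hn)
  refine ⟨S₂, h2, fun x hx y hy hxy => ?_⟩
  have hmem : ∀ z ∉ S₂, (z : ℕ) + 1 ∈ (seqOf π).filter (fun z => decide (z ∉ S)) := by
    intro z hz
    rw [List.mem_filter]
    refine ⟨?_, ?_⟩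
    · rw [seqOf, List.mem_ofFn]
      exact ⟨π⁻¹ z, by simp⟩
    · have : (z : ℕ) + 1 ∉ S := fun h => hz (h12 (by simpa [hS₁] using h))
      simpa using this
  have hπ := (pairwise_seqOf π).sublist
    (List.filter_sublist (p := fun z => decide (z ∉ S)))
  have hσ := (pairwise_seqOf σ).sublist
    (List.filter_sublist (p := fun z => decide (z ∉ S)))
  rw [← hS'] at hσ
  have hboth := (hπ.and hσ).imp (S := fun u v => ∀ x y : Fin n, (x : ℕ) + 1 = u →
    (y : ℕ) + 1 = v → (π⁻¹ x < π⁻¹ y ∧ σ⁻¹ x < σ⁻¹ y) ∨ (π⁻¹ y < π⁻¹ x ∧ σ⁻¹ y < σ⁻¹ x))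
    fun h x y hx hy => Or.inl ⟨h.1 x y hx hy, h.2 x y hx hy⟩
  have hne : (x : ℕ) + 1 ≠ (y : ℕ) + 1 := by
    intro h
    have : x = y := Fin.ext (by omega)
    subst this
    exact lt_irrefl _ hxy
  have hsymm : Std.Symm fun u v : ℕ => ∀ x y : Fin n, (x : ℕ) + 1 = u → (y : ℕ) + 1 = v →
      (π⁻¹ x < π⁻¹ y ∧ σ⁻¹ x < σ⁻¹ y) ∨ (π⁻¹ y < π⁻¹ x ∧ σ⁻¹ y < σ⁻¹ x) :=
    ⟨fun u v h x y hx hy => (h y x hy hx).symm⟩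
  have := hboth.forall (hmem x hx) (hmem y hy) hne x y rfl rfl
  rcases this with h | h
  · exact h.2
  · exact absurd hxy h.1.asymm

end Translocations

section Counting

open Finset

variable {n : ℕ}

lemma AgreeOff.symm {t : ℕ} {p q : Equiv.Perm (Fin n)} (h : AgreeOff t p q) :
    AgreeOff t q p := by
  obtain ⟨S, hS, h⟩ := h
  refine ⟨S, hS, fun x hx y hy hxy => ?_⟩
  by_contra hc
  rcases (not_lt.1 hc).lt_or_eq with h' | h'
  · exact (h y hy x hx h').asymm hxy
  · rw [p.injective h'] at hxy
    exact lt_irrefl _ hxy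

lemma AgreeOff.mul_right {t : ℕ} {p q : Equiv.Perm (Fin n)} (h : AgreeOff t p q)
    (r : Equiv.Perm (Fin n)) : AgreeOff t (p * r) (q * r) := by
  obtain ⟨S, hS, h⟩ := h
  refine ⟨S.map r.symm.toEmbedding, by simpa using hS, fun x hx y hy hxy => ?_⟩
  rw [mem_map_equiv, Equiv.symm_symm] at hx hy
  exact h _ hx _ hy hxy

/-- A permutation increasing off `S` is determined by its values on `S`. -/
lemma eq_of_monotone_off {S : Finset (Fin n)} {p q : Equiv.Perm (Fin n)}
    (hp : ∀ x ∉ S, ∀ y ∉ S, x < y → p x < p y) (hq : ∀ x ∉ S, ∀ y ∉ S, x < y → q x < q y)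
    (h : ∀ x ∈ S, p x = q x) : p = q := by
  have key : ∀ p q : Equiv.Perm (Fin n), (∀ x ∉ S, ∀ y ∉ S, x < y → p x < p y) →
      (∀ x ∉ S, ∀ y ∉ S, x < y → q x < q y) → (∀ x ∈ S, p x = q x) →
      ∀ x, (∀ y < x, p y = q y) → q x ≤ p x := by
    intro p q hp hq h x ih
    by_contra hc
    rw [not_le] at hc
    have hxS : x ∉ S := fun hx => by rw [h x hx] at hc; exact lt_irrefl _ hc
    obtain ⟨z, hz⟩ := q.surjective (p x)
    have hzS : z ∉ S := fun hz' => by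
      rw [← h z hz'] at hz
      exact hxS (p.injective hz ▸ hz')
    rcases lt_trichotomy z x with hzx | rfl | hzx
    · rw [← ih z hzx] at hz
      exact hzx.ne (p.injective hz)
    · rw [hz] at hc
      exact lt_irrefl _ hc
    · have := hq x hxS z hzS hzx
      rw [hz] at this
      exact this.asymm hc
  ext1 x
  induction x using WellFoundedLT.induction with
  | ind x ih =>
    exact le_antisymm (key q p hq hp (fun x hx => (h x hx).symm) x fun y hy => (ih y hy).symm)
      (key p q hp hq h x ih)

/-- `f` lists the points and the values of `p` on a `t`-set off which `p` is increasing. -/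
def IsCode {t : ℕ} (p : Equiv.Perm (Fin n)) (f : Fin t → Fin n × Fin n) : Prop :=
  (∀ x ∉ univ.image (fun i => (f i).1), ∀ y ∉ univ.image (fun i => (f i).1), x < y → p x < p y) ∧
    (univ.image fun i => (f i).1).card = t ∧ ∀ i, p (f i).1 = (f i).2

lemma exists_isCode {t : ℕ} {p : Equiv.Perm (Fin n)} (h : AgreeOff t 1 p) :
    ∃ f : Fin t → Fin n × Fin n, IsCode p f := by
  obtain ⟨S, hS, h⟩ := h
  have e : univ.image (fun i => S.orderEmbOfFin hS i) = S := by
    ext x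
    rw [← mem_coe, ← mem_coe, ← S.range_orderEmbOfFin hS]
    simp
  refine ⟨fun i => (S.orderEmbOfFin hS i, p (S.orderEmbOfFin hS i)), ?_, ?_, fun _ => rfl⟩
  · simp only [e]
    exact h
  · simp only [e]
    exact hS

lemma IsCode.eq {t : ℕ} {p q : Equiv.Perm (Fin n)} {f : Fin t → Fin n × Fin n}
    (hp : IsCode p f) (hq : IsCode q f) : p = q := by
  refine eq_of_monotone_off hp.1 hq.1 fun x hx => ?_
  obtain ⟨i, -, rfl⟩ := mem_image.1 hx
  rw [hp.2.2, hq.2.2]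

lemma card_le_of_isCode_mem {t : ℕ} {A : Finset (Equiv.Perm (Fin n))}
    {B : Finset (Fin t → Fin n × Fin n)} (h : ∀ p ∈ A, ∃ f ∈ B, IsCode p f) :
    #A ≤ #B := by
  exact card_le_card_of_forall_subsingleton IsCode h fun f _ p hp q hq => hp.2.eq hq.2

/-- The pairs whose first entry is in `R` or differs from the second by at most `2 * t`. -/
def badEntries (t : ℕ) (R : Finset (Fin n)) : Finset (Fin n × Fin n) :=
  (R ×ˢ univ) ∪ univ.filter fun a => (a.1 : ℕ) ≤ a.2 + 2 * t ∧ (a.2 : ℕ) ≤ a.1 + 2 * t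

lemma card_badEntries_le (t : ℕ) (R : Finset (Fin n)) :
    #(badEntries t R) ≤ (#R + (4 * t + 1)) * n := by
  refine (card_union_le _ _).trans ?_
  rw [card_product, card_univ, Fintype.card_fin, add_mul]
  refine Nat.add_le_add_left ?_ _
  have : #(univ.filter fun a : Fin n × Fin n =>
      (a.1 : ℕ) ≤ a.2 + 2 * t ∧ (a.2 : ℕ) ≤ a.1 + 2 * t) ≤
      #((range (4 * t + 1)) ×ˢ (univ : Finset (Fin n))) := by
    refine card_le_card_of_injOn (fun a => ((a.2 : ℕ) + 2 * t - a.1, a.1)) ?_ ?_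
    · intro a ha
      simp only [coe_filter, mem_univ, true_and, Set.mem_ofPred_eq] at ha
      simp only [coe_product, Set.mem_prod, mem_coe, mem_range, mem_univ, and_true]
      omega
    · intro a ha b hb hab
      simp only [coe_filter, mem_univ, true_and, Set.mem_ofPred_eq] at ha hb
      simp only [Prod.mk.injEq] at hab
      obtain ⟨h1, h2⟩ := hab
      rw [h2] at h1 ha
      exact Prod.ext h2 (Fin.ext (by omega))
  simpa using this

lemma card_exists_mem_le {t : ℕ} {β : Type*} [Fintype β] [DecidableEq β] (E : Finset β) :
    #(univ.filter fun f : Fin t → β => ∃ i, f i ∈ E) ≤ t * (#E * Fintype.card β ^ (t - 1)) := by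
  have h1 : (univ.filter fun f : Fin t → β => ∃ i, f i ∈ E) ⊆
      univ.biUnion fun i => Fintype.piFinset fun j => if j = i then E else univ := by
    intro f hf
    obtain ⟨i, hi⟩ := (mem_filter.1 hf).2
    refine mem_biUnion.2 ⟨i, mem_univ _, Fintype.mem_piFinset.2 fun j => ?_⟩
    by_cases h : j = i
    · subst h; simpa using hi
    · simp [h]
  refine (card_le_card h1).trans (card_biUnion_le.trans ?_)
  refine (sum_le_card_nsmul _ _ (#E * Fintype.card β ^ (t - 1)) fun i _ => ?_).trans_eq
    (by simp)
  rw [Fintype.card_piFinset, ← mul_prod_erase _ _ (mem_univ i), if_pos rfl]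
  refine (Nat.mul_le_mul_left _ (le_of_eq ?_))
  rw [prod_congr rfl (g := fun _ => Fintype.card β) fun j hj => by
    rw [if_neg (ne_of_mem_erase hj), card_univ]]
  simp

lemma card_agreeOff_one_le (t : ℕ) :
    #(univ.filter fun p : Equiv.Perm (Fin n) => AgreeOff t 1 p) ≤ n ^ (2 * t) := by
  refine (card_le_of_isCode_mem (t := t) (B := univ) fun p hp => ?_).trans_eq ?_
  · obtain ⟨f, hf⟩ := exists_isCode (mem_filter.1 hp).2
    exact ⟨f, mem_univ _, hf⟩
  · simp [pow_mul, sq]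

lemma card_filter_perm_lt (p : Equiv.Perm (Fin n)) (s : Fin n) :
    #(univ.filter fun z => p z < p s) = p s := by
  rw [← Fin.card_Iio (p s)]
  refine card_nbij' p p.symm ?_ ?_ ?_ ?_ <;> intro z <;> simp

/-- A symbol that is displaced a lot by `q` is out of order with a symbol outside a small set. -/
lemma exists_inversion {t : ℕ} {q : Equiv.Perm (Fin n)} {s : Fin n}
    (hs : ¬ ((s : ℕ) ≤ q s + 2 * t ∧ (q s : ℕ) ≤ s + 2 * t)) {T : Finset (Fin n)}
    (hT : #T ≤ 2 * t) :
    ∃ z ∉ T, (z < s ∧ q s < q z) ∨ (s < z ∧ q z < q s) := by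
  have h1 : #(univ.filter fun z => z < s) = s := by
    convert card_filter_perm_lt 1 s <;> rfl
  have h2 := card_filter_perm_lt q s
  rw [not_and_or, not_le, not_le] at hs
  rcases hs with hs | hs
  · have := le_card_sdiff (univ.filter fun z => q z < q s) (univ.filter fun z => z < s)
    obtain ⟨z, hz, hzT⟩ := exists_mem_notMem_of_card_lt_card
      (s := T) (t := (univ.filter fun z => z < s) \ (univ.filter fun z => q z < q s)) (by omega)
    simp only [mem_sdiff, mem_filter, mem_univ, true_and, not_lt] at hz
    exact ⟨z, hzT, Or.inl ⟨hz.1, lt_of_le_of_ne hz.2 fun h => hz.1.ne (q.injective h).symm⟩⟩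
  · have := le_card_sdiff (univ.filter fun z => z < s) (univ.filter fun z => q z < q s)
    obtain ⟨z, hz, hzT⟩ := exists_mem_notMem_of_card_lt_card
      (s := T) (t := (univ.filter fun z => q z < q s) \ (univ.filter fun z => z < s)) (by omega)
    simp only [mem_sdiff, mem_filter, mem_univ, true_and, not_lt] at hz
    refine ⟨z, hzT, Or.inr ⟨lt_of_le_of_ne hz.2 ?_, hz.1⟩⟩
    rintro rfl
    exact lt_irrefl _ hz.1

lemma exists_inversion_of_ne_one {p : Equiv.Perm (Fin n)} (hp : p ≠ 1) :
    ∃ a b, a < b ∧ p b < p a := by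
  by_contra! h
  refine hp (eq_of_monotone_off (S := ∅) (fun x _ y _ hxy => ?_) (fun x _ y _ hxy => hxy) (by simp))
  exact lt_of_le_of_ne (h x y hxy) fun h => hxy.ne (p.injective h)

lemma card_common_agreeOff_le {t : ℕ} {p : Equiv.Perm (Fin n)} (hp : p ≠ 1)
    (h1p : AgreeOff t 1 p) :
    #(univ.filter fun q : Equiv.Perm (Fin n) => AgreeOff t 1 q ∧ AgreeOff t p q) ≤
      t * ((5 * t + 3) * n * (n * n) ^ (t - 1)) := by
  obtain ⟨R, hR, hpR⟩ := h1p
  obtain ⟨a, b, hab, hba⟩ := exists_inversion_of_ne_one hp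
  set E := badEntries t (insert a (insert b R)) with hE
  have hcard : #E ≤ (5 * t + 3) * n := by
    refine (card_badEntries_le _ _).trans (Nat.mul_le_mul_right _ ?_)
    have := card_insert_le a (insert b R)
    have := card_insert_le b R
    omega
  have hmain : #(univ.filter fun q : Equiv.Perm (Fin n) => AgreeOff t 1 q ∧ AgreeOff t p q) ≤
      #(univ.filter fun f : Fin t → Fin n × Fin n => ∃ i, f i ∈ E) := by
    refine card_le_of_isCode_mem fun q hq => ?_
    obtain ⟨-, hq1, T, hT, hpq⟩ := mem_filter.1 hq
    obtain ⟨f, hf⟩ := exists_isCode hq1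
    refine ⟨f, mem_filter.2 ⟨mem_univ _, ?_⟩, hf⟩
    by_contra! hgood
    obtain ⟨hmono, hSc, hval⟩ := hf
    set S := univ.image (fun i => (f i).1) with hS
    have hprop : ∀ s ∈ S, s ∉ insert a (insert b R) ∧
        ¬ ((s : ℕ) ≤ q s + 2 * t ∧ (q s : ℕ) ≤ s + 2 * t) := by
      intro s hs
      obtain ⟨i, -, rfl⟩ := mem_image.1 hs
      have := hgood i
      rw [hE, badEntries, mem_union, not_or, mem_product, mem_filter] at this
      rw [hval i]
      simpa using this
    have hST : S ⊆ T := by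
      intro s hs
      by_contra hsT
      obtain ⟨hsR, hs'⟩ := hprop s hs
      have hsR : s ∉ R := fun h => hsR (mem_insert_of_mem (mem_insert_of_mem h))
      obtain ⟨z, hz, hinv⟩ := exists_inversion hs' (T := T ∪ R)
        ((card_union_le _ _).trans (by omega))
      rw [mem_union, not_or] at hz
      rcases hinv with ⟨h1, h2⟩ | ⟨h1, h2⟩
      · exact (hpq z hz.1 s hsT (hpR z hz.2 s hsR h1)).asymm h2
      · exact (hpq s hsT z hz.1 (hpR s hsR z hz.2 h1)).asymm h2
    have hSTe : S = T := eq_of_subset_of_card_le hST (by omega)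
    have haS : a ∉ S := fun h => (hprop a h).1 (by simp)
    have hbS : b ∉ S := fun h => (hprop b h).1 (by simp)
    exact (hpq b (hSTe ▸ hbS) a (hSTe ▸ haS) hba).asymm (hmono a haS b hbS hab)
  refine hmain.trans ((card_exists_mem_le E).trans ?_)
  rw [Fintype.card_prod, Fintype.card_fin]
  exact Nat.mul_le_mul_left _ (Nat.mul_le_mul_right _ hcard)

/-- The graph of pairs of distinct position functions that agree off a `t`-set. -/
def agreeGraph (n t : ℕ) : SimpleGraph (Equiv.Perm (Fin n)) where
  Adj p q := p ≠ q ∧ AgreeOff t p q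
  symm := ⟨fun _ _ h => ⟨h.1.symm, h.2.symm⟩⟩
  loopless := ⟨fun _ h => h.1 rfl⟩

lemma agreeGraph_degree_le (n t : ℕ) (p : Equiv.Perm (Fin n)) :
    #(univ.filter fun q => (agreeGraph n t).Adj p q) ≤ n ^ (2 * t) := by
  refine le_trans (card_le_card_of_injOn (fun q => q * p⁻¹) ?_ ?_) (card_agreeOff_one_le (n := n) t)
  · intro q hq
    have := ((mem_filter.1 hq).2.2).mul_right p⁻¹
    rw [mul_inv_cancel] at this
    exact mem_filter.2 ⟨mem_univ _, this⟩
  · exact (mul_left_injective p⁻¹).injOn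

lemma agreeGraph_codegree_le (n t : ℕ) (p r : Equiv.Perm (Fin n))
    (h : (agreeGraph n t).Adj p r) :
    #(univ.filter fun q => (agreeGraph n t).Adj p q ∧ (agreeGraph n t).Adj r q) ≤
      t * ((5 * t + 3) * n * (n * n) ^ (t - 1)) := by
  have h1 : r * p⁻¹ ≠ 1 := fun e => h.1 (mul_inv_eq_one.1 e).symm
  have h2 := h.2.mul_right p⁻¹
  rw [mul_inv_cancel] at h2
  refine le_trans (card_le_card_of_injOn (fun q => q * p⁻¹) ?_ ?_) (card_common_agreeOff_le h1 h2)
  · intro q hq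
    obtain ⟨-, hq1, hq2⟩ := mem_filter.1 hq
    have := hq1.2.mul_right p⁻¹
    rw [mul_inv_cancel] at this
    exact mem_filter.2 ⟨mem_univ _, this, hq2.2.mul_right p⁻¹⟩
  · exact (mul_left_injective p⁻¹).injOn

lemma card_le_Mnt {n t : ℕ} (C : Finset (Equiv.Perm (Fin n)))
    (hC : ∀ π ∈ C, ∀ σ ∈ C, π ≠ σ → t < dU π σ) : #C ≤ Mnt n t := by
  refine le_csSup ⟨Fintype.card (Equiv.Perm (Fin n)), ?_⟩ ⟨C, hC, rfl⟩
  rintro m ⟨C, -, rfl⟩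
  exact card_le_univ C

lemma card_le_Mnt_of_indep {n t : ℕ} (hn : t ≤ n) (C : Finset (Equiv.Perm (Fin n)))
    (hC : ∀ p ∈ C, ∀ q ∈ C, ¬ (agreeGraph n t).Adj p q) : #C ≤ Mnt n t := by
  rw [← card_map (Equiv.inv (Equiv.Perm (Fin n))).toEmbedding]
  refine card_le_Mnt _ fun π hπ σ hσ hne => ?_
  obtain ⟨p, hp, rfl⟩ := mem_map.1 hπ
  obtain ⟨q, hq, rfl⟩ := mem_map.1 hσ
  by_contra! hle
  have := agreeOff_of_dU_le hn hle
  simp only [Equiv.coe_toEmbedding, Equiv.inv_apply, inv_inv] at this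
  exact hC p hp q hq ⟨fun h => hne (by rw [h]), this⟩

end Counting

/-- improved GV bound: for every fixed `t ≥ 1` there are `c > 0` and `N`
such that `M(n,t) ≥ c · n! · log₂ n / n^{2t}` for all `n ≥ N`. -/
theorem stmt2 (t : ℕ) (ht : 1 ≤ t) :
    ∃ c : ℝ, 0 < c ∧ ∃ N : ℕ, ∀ n : ℕ, N ≤ n →
      c * (n.factorial : ℝ) * Real.logb 2 (n : ℝ) / (n : ℝ) ^ (2 * t) ≤ (Mnt n t : ℝ) := by
  set L : ℕ := t * (5 * t + 3) with hL
  have hL0 : 0 < L := by positivity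
  refine ⟨Real.log 2 / (8 * (Real.exp 2 + 1)), by positivity, L ^ 2 + t, fun n hn => ?_⟩
  have hLn : L ^ 2 ≤ n := by omega
  have hLn' : L ≤ n := le_trans (Nat.le_self_pow two_ne_zero L) hLn
  have hn0 : 0 < n := by omega
  set l : ℕ := t * ((5 * t + 3) * n * (n * n) ^ (t - 1)) with hl
  have hll : l * n = L * n ^ (2 * t) := by
    obtain ⟨s, rfl⟩ : ∃ s, t = s + 1 := ⟨t - 1, by omega⟩
    rw [hl, hL, Nat.add_sub_cancel, ← sq, ← pow_mul]
    ring
  have hl1 : 1 ≤ l := by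
    rw [hl]
    exact Nat.succ_le_of_lt (by positivity)
  have hlD : l ≤ n ^ (2 * t) := by
    refine Nat.le_of_mul_le_mul_right ?_ hn0
    rw [hll, mul_comm]
    exact Nat.mul_le_mul_left _ hLn'
  obtain ⟨C, hC, hcard⟩ := exists_large_indepSet (G := agreeGraph n t) hl1 hlD
    (fun p => by convert agreeGraph_degree_le n t p)
    (fun p r h => by convert agreeGraph_codegree_le n t p r h)
  have hM : (C.card : ℝ) ≤ Mnt n t := by
    exact_mod_cast card_le_Mnt_of_indep (by omega) C hC
  refine le_trans ?_ hM
  have hnR : (0 : ℝ) < n := by exact_mod_cast hn0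
  have hLR : (0 : ℝ) < L := by exact_mod_cast hL0
  have hlR : (0 : ℝ) < l := by exact_mod_cast hl1
  have hratio : ((n ^ (2 * t) : ℕ) : ℝ) / l = n / L := by
    rw [div_eq_div_iff hlR.ne' hLR.ne']
    have : (l : ℝ) * n = L * (n ^ (2 * t) : ℕ) := by exact_mod_cast hll
    linarith
  have hlog : Real.log n / 2 ≤ Real.log (n / L) := by
    rw [Real.log_div hnR.ne' hLR.ne']
    have : Real.log ((L : ℝ) ^ 2) ≤ Real.log n :=
      Real.log_le_log (by positivity) (by exact_mod_cast hLn)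
    rw [Real.log_pow] at this
    push_cast at this
    linarith
  rw [hratio, Fintype.card_perm, Fintype.card_fin, Nat.cast_pow] at hcard
  rw [div_le_iff₀ (by positivity), Real.logb]
  have h2 : Real.log 2 ≠ 0 := (Real.log_pos one_lt_two).ne'
  have hmul : (n.factorial : ℝ) * (Real.log n / 2 / (2 * (Real.exp 2 + 1))) ≤
      2 * (n : ℝ) ^ (2 * t) * C.card := le_trans (by gcongr) hcard
  have e : Real.log 2 / (8 * (Real.exp 2 + 1)) * (n.factorial : ℝ) *
      (Real.log n / Real.log 2) =
      (n.factorial : ℝ) * (Real.log n / 2 / (2 * (Real.exp 2 + 1))) / 2 := by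
    field_simp
    ring
  rw [e]
  linarith
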